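/- Let f : ℝ^n → ℝ be a continuous piecewise linear function with p ≥ 2 pieces. Then there exists a shortcut linear threshold neural network with 2 hidden layers that computes f exactly and has size at most p² + 1. -/

import Mathlib

open Finset MeasureTheory

noncomputable section

/-- The threshold activation function. -/
def thresh (t : ℝ) : ℝ := if 0 < t then 1 else 0

/-- `T` is an affine map from `ℝ^a` to `ℝ^b`. -/
def IsAffineMap {a b : ℕ} (T : (Fin a → ℝ) → (Fin b → ℝ)) : Prop :=
  ∃ (M : Fin b → Fin a → ℝ) (c : Fin b → ℝ),
    ∀ x j, T x j = (∑ i, M j i * x i) + c j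

/-- `Hidden n k s w g` : `g = σ ∘ T_k ∘ ⋯ ∘ σ ∘ T_1 : ℝ^n → ℝ^w` is the function computed
by `k` hidden threshold layers, where the last hidden layer has width `w` and the total
number of hidden neurons (the size) is `s`. -/
inductive Hidden (n : ℕ) : ℕ → ℕ → (w : ℕ) → ((Fin n → ℝ) → (Fin w → ℝ)) → Prop
  | single {w : ℕ} (T : (Fin n → ℝ) → (Fin w → ℝ)) (hT : IsAffineMap T) :
      Hidden n 1 w w (fun x j => thresh (T x j))
  | comp {k s w w' : ℕ} {g : (Fin n → ℝ) → (Fin w → ℝ)}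
      (T : (Fin w → ℝ) → (Fin w' → ℝ)) (hg : Hidden n k s w g) (hT : IsAffineMap T) :
      Hidden n (k + 1) (s + w') w' (fun x j => thresh (T (g x) j))

/-- `f : ℝ^n → ℝ` is computed by a linear threshold neural network with `k` hidden layers
and size (number of hidden neurons) `s`. -/
def LTComputes (n k s : ℕ) (f : (Fin n → ℝ) → ℝ) : Prop :=
  ∃ (w : ℕ) (g : (Fin n → ℝ) → (Fin w → ℝ)) (a : Fin w → ℝ) (c : ℝ),
    Hidden n k s w g ∧ ∀ x, f x = (∑ j, a j * g x j) + c

/-- A polyhedron in `ℝ^n`: the intersection of finitely many closed halfspaces. -/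
def IsPolyhedron {n : ℕ} (P : Set (Fin n → ℝ)) : Prop :=
  ∃ (m : ℕ) (a : Fin m → Fin n → ℝ) (b : Fin m → ℝ),
    P = {x | ∀ i, (∑ j, a i j * x j) ≤ b i}

/-- `F` is a face of the polyhedron `P`. -/
def IsFace {n : ℕ} (F P : Set (Fin n → ℝ)) : Prop :=
  ∃ (c : Fin n → ℝ) (d : ℝ),
    (∀ x ∈ P, (∑ j, c j * x j) ≤ d) ∧ F = {x ∈ P | (∑ j, c j * x j) = d}

/-- A (finite) polyhedral complex in `ℝ^n`. -/
def IsPolyhedralComplex {n : ℕ} (Pc : Finset (Set (Fin n → ℝ))) : Prop :=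
  (∀ P ∈ Pc, IsPolyhedron P) ∧
  (∀ P ∈ Pc, ∀ Q ∈ Pc, IsFace (P ∩ Q) P ∧ IsFace (P ∩ Q) Q) ∧
  (∀ P ∈ Pc, ∀ F, IsFace F P → F ∈ Pc)

/-- The union of the members of `Pc` is all of `ℝ^n`. -/
def Covers {n : ℕ} (Pc : Finset (Set (Fin n → ℝ))) : Prop :=
  ⋃₀ (Pc : Set (Set (Fin n → ℝ))) = Set.univ

/-- The dimension of a polyhedron: the dimension of its affine hull. -/
def polyDim {n : ℕ} (P : Set (Fin n → ℝ)) : ℕ :=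
  Module.finrank ℝ (affineSpan ℝ P).direction

/-- `Pc` is a polyhedral complex covering `ℝ^n` with which `f` is compatible as a piecewise
constant function: `f` is constant on the relative interior of each member of `Pc`. -/
def CompatiblePWC {n : ℕ} (f : (Fin n → ℝ) → ℝ) (Pc : Finset (Set (Fin n → ℝ))) : Prop :=
  IsPolyhedralComplex Pc ∧ Covers Pc ∧
    ∀ P ∈ Pc, ∃ c : ℝ, ∀ x ∈ intrinsicInterior ℝ P, f x = c

/-- `f : ℝ^n → ℝ` is piecewise constant. -/
def IsPWC {n : ℕ} (f : (Fin n → ℝ) → ℝ) : Prop := ∃ Pc, CompatiblePWC f Pc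

/-- The cardinality `|Pc*_f|` of a minimum-cardinality polyhedral complex compatible with `f`. -/
def minCardPWC {n : ℕ} (f : (Fin n → ℝ) → ℝ) : ℕ :=
  sInf {c : ℕ | ∃ Pc, CompatiblePWC f Pc ∧ Pc.card = c}

/-- `f : ℝ^n → ℝ` is computed by a shortcut linear threshold neural network with `k` hidden
layers and size `s`: the output is `⟨Aᵀ x + b, x⁽ᵏ⁾⟩` where `x⁽ᵏ⁾` is the output of the
last hidden layer. -/
def SLTComputes (n k s : ℕ) (f : (Fin n → ℝ) → ℝ) : Prop :=
  ∃ (w : ℕ) (g : (Fin n → ℝ) → (Fin w → ℝ)) (A : Fin n → Fin w → ℝ) (b : Fin w → ℝ),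
    Hidden n k s w g ∧ ∀ x, f x = ∑ j, ((∑ i, A i j * x i) + b j) * g x j

/-- `Pc` is a polyhedral complex covering `ℝ^n` with which `f` is compatible as a piecewise
linear function: `f` is affine linear on the relative interior of each member of `Pc`. -/
def CompatiblePWL {n : ℕ} (f : (Fin n → ℝ) → ℝ) (Pc : Finset (Set (Fin n → ℝ))) : Prop :=
  IsPolyhedralComplex Pc ∧ Covers Pc ∧
    ∀ P ∈ Pc, ∃ (a : Fin n → ℝ) (c : ℝ),
      ∀ x ∈ intrinsicInterior ℝ P, f x = (∑ i, a i * x i) + c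

/-- `f : ℝ^n → ℝ` is piecewise linear. -/
def IsPWL {n : ℕ} (f : (Fin n → ℝ) → ℝ) : Prop := ∃ Pc, CompatiblePWL f Pc

lemma IsPolyhedron.isClosed {n : ℕ} {P : Set (Fin n → ℝ)} (hP : IsPolyhedron P) : IsClosed P := by
  obtain ⟨m, a, b, rfl⟩ := hP
  simp only [Set.ofPred_forall]
  exact isClosed_iInter fun i => isClosed_le (by fun_prop) continuous_const

lemma IsPolyhedron.convex {n : ℕ} {P : Set (Fin n → ℝ)} (hP : IsPolyhedron P) : Convex ℝ P := by
  obtain ⟨m, a, b, rfl⟩ := hP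
  simp only [Set.ofPred_forall]
  refine convex_iInter fun i => convex_halfSpace_le ⟨fun x y => ?_, fun c x => ?_⟩ _
  · simp [mul_add, Finset.sum_add_distrib]
  · simp [Finset.mul_sum, mul_left_comm]

lemma polyDim_eq_of_interior_nonempty {n : ℕ} {P : Set (Fin n → ℝ)}
    (hP : (interior P).Nonempty) : polyDim P = n := by
  have h : affineSpan ℝ P = ⊤ := top_unique <|
    (isOpen_interior.affineSpan_eq_top hP).ge.trans (affineSpan_mono ℝ interior_subset)
  rw [polyDim, h, AffineSubspace.direction_top, finrank_top, Module.finrank_fin_fun]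

/-- A face of `P` containing an interior point of `P` is all of `P`. -/
lemma IsFace.eq_of_mem_interior {n : ℕ} {F P : Set (Fin n → ℝ)} (h : IsFace F P)
    {x : Fin n → ℝ} (hxF : x ∈ F) (hx : x ∈ interior P) : F = P := by
  obtain ⟨c, d, hle, rfl⟩ := h
  have hc : c = 0 := by
    have hlim : Filter.Tendsto (fun ε : ℝ => x + ε • c) (nhdsWithin 0 (Set.Ioi 0)) (nhds x) := by
      have : Continuous (fun ε : ℝ => x + ε • c) := by fun_prop
      simpa using (this.tendsto 0).mono_left nhdsWithin_le_nhds
    have hmem := hlim.eventually (mem_interior_iff_mem_nhds.mp hx)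
    obtain ⟨ε, hε, hpos⟩ := (hmem.and self_mem_nhdsWithin).exists
    have h1 := hle _ hε
    have h2 : ∑ j, c j * (x + ε • c) j = d + ε * ∑ j, c j * c j := by
      rw [← hxF.2, Finset.mul_sum, ← Finset.sum_add_distrib]
      exact Finset.sum_congr rfl fun j _ => by simp; ring
    have h3 : ∑ j, c j * c j ≤ 0 := by
      have : (0 : ℝ) < ε := hpos
      by_contra! h
      nlinarith [mul_pos this h]
    have h4 := (Finset.sum_eq_zero_iff_of_nonneg fun j _ => mul_self_nonneg (c j)).mp
      (h3.antisymm (Finset.sum_nonneg fun j _ => mul_self_nonneg (c j)))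
    exact funext fun j => by simpa using h4 j (Finset.mem_univ j)
  subst hc
  have hd : 0 = d := by simpa using hxF.2
  simp [← hd]

lemma IsPolyhedralComplex.disjoint_interior {n : ℕ} {Pc : Finset (Set (Fin n → ℝ))}
    (h : IsPolyhedralComplex Pc) {P Q : Set (Fin n → ℝ)} (hP : P ∈ Pc) (hQ : Q ∈ Pc)
    (hne : P ≠ Q) : Disjoint (interior P) (interior Q) := by
  refine Set.disjoint_left.mpr fun x hxP hxQ => hne ?_
  have hx : x ∈ P ∩ Q := ⟨interior_subset hxP, interior_subset hxQ⟩
  obtain ⟨h1, h2⟩ := h.2.1 P hP Q hQ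
  exact (h1.eq_of_mem_interior hx hxP).symm.trans (h2.eq_of_mem_interior hx hxQ)

/-- The members with nonempty interior of a finite closed cover already form a cover. -/
lemma exists_mem_interior_nonempty_of_cover {X : Type*} [TopologicalSpace X]
    (S : Finset (Set X)) (hclosed : ∀ P ∈ S, IsClosed P)
    (hcov : ⋃₀ (S : Set (Set X)) = Set.univ) (x : X) :
    ∃ P ∈ S, (interior P).Nonempty ∧ x ∈ P := by
  classical
  by_contra! hx
  have hthin : ∀ T : Finset (Set X), (∀ P ∈ T, IsClosed P ∧ interior P = ∅) →
      interior (⋃₀ (T : Set (Set X))) = ∅ := by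
    intro T
    induction T using Finset.induction_on with
    | empty => simp
    | insert P T _ ih =>
      intro hT
      rw [Finset.coe_insert, Set.sUnion_insert,
        interior_union_isClosed_of_interior_empty (hT P (by simp)).1
          (ih fun Q hQ => hT Q (by simp [hQ]))]
      exact (hT P (by simp)).2
  have hfat : IsClosed (⋃₀ {P | P ∈ S ∧ (interior P).Nonempty}) :=
    Set.sUnion_eq_biUnion ▸ Set.Finite.isClosed_biUnion
      (S.finite_toSet.subset fun P hP => hP.1) fun P hP => hclosed P hP.1
  have hsub : (⋃₀ {P | P ∈ S ∧ (interior P).Nonempty})ᶜ ⊆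
      ⋃₀ ((S.filter fun P => interior P = ∅ : Finset (Set X)) : Set (Set X)) := by
    intro y hy
    obtain ⟨P, hP, hyP⟩ := Set.mem_sUnion.mp (hcov.ge (Set.mem_univ y))
    refine ⟨P, ?_, hyP⟩
    simp only [Finset.coe_filter, Set.mem_ofPred_eq]
    refine ⟨hP, Set.not_nonempty_iff_eq_empty.mp fun hne => hy ⟨P, ⟨hP, hne⟩, hyP⟩⟩
  have hmem := interior_maximal hsub hfat.isOpen_compl
    (show x ∈ _ from fun ⟨P, hP, hxP⟩ => hx P hP.1 hP.2 hxP)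
  rw [hthin _ fun P hP => ⟨hclosed P (Finset.mem_filter.mp hP).1, (Finset.mem_filter.mp hP).2⟩]
    at hmem
  exact hmem

/-- Convex sets with nonempty disjoint interiors are separated by a nonzero functional. -/
lemma exists_separating {n : ℕ} {P Q : Set (Fin n → ℝ)} (hP : Convex ℝ P) (hQ : Convex ℝ Q)
    (hP' : (interior P).Nonempty) (hQ' : (interior Q).Nonempty)
    (hd : Disjoint (interior P) (interior Q)) :
    ∃ (l : (Fin n → ℝ) →L[ℝ] ℝ) (u : ℝ), l ≠ 0 ∧ (∀ x ∈ P, l x ≤ u) ∧ ∀ x ∈ Q, u ≤ l x := by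
  obtain ⟨l, u, h1, h2⟩ := geometric_hahn_banach_open_open hP.interior isOpen_interior
    hQ.interior isOpen_interior hd
  refine ⟨l, u, ?_, fun x hx => ?_, fun x hx => ?_⟩
  · rintro rfl
    obtain ⟨x, hx⟩ := hP'
    obtain ⟨y, hy⟩ := hQ'
    exact lt_asymm (h1 x hx) (h2 y hy)
  · exact closure_minimal (fun y hy => (h1 y hy).le) (isClosed_le l.continuous continuous_const)
      ((hP.closure_interior_eq_closure_of_nonempty_interior hP').ge (subset_closure hx))
  · exact closure_minimal (fun y hy => (h2 y hy).le) (isClosed_le continuous_const l.continuous)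
      ((hQ.closure_interior_eq_closure_of_nonempty_interior hQ').ge (subset_closure hx))

/-- A network with two hidden layers whose neurons are indexed by arbitrary finite types. -/
lemma sltComputes_two {n : ℕ} {κ ι : Type*} [Fintype κ] [Fintype ι]
    (l : κ → (Fin n → ℝ) →L[ℝ] ℝ) (b : κ → ℝ) (M : ι → κ → ℝ) (c : ι → ℝ)
    (A : ι → Fin n → ℝ) (B : ι → ℝ) :
    SLTComputes n 2 (Fintype.card κ + Fintype.card ι) (fun x =>
      ∑ i, ((∑ k, A i k * x k) + B i) *
        thresh ((∑ q, M i q * thresh (l q x + b q)) + c i)) := by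
  let e := Fintype.equivFin κ
  let e' := Fintype.equivFin ι
  refine ⟨_, _, fun k j => A (e'.symm j) k, fun j => B (e'.symm j),
    Hidden.comp (fun y j => (∑ q, M (e'.symm j) (e.symm q) * y q) + c (e'.symm j))
      (Hidden.single (fun x j => l (e.symm j) x + b (e.symm j)) ?_) ?_, fun x => ?_⟩
  · refine ⟨fun j i => l (e.symm j) (Pi.single i 1), fun j => b (e.symm j), fun x j => ?_⟩
    have hx : x = ∑ i, x i • Pi.single i (1 : ℝ) := by
      simp [← Pi.single_smul, Finset.univ_sum_single]
    dsimp only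
    conv_lhs => rw [hx, map_sum]
    congr 1
    exact Finset.sum_congr rfl fun i _ => by rw [map_smul, smul_eq_mul, mul_comm]
  · exact ⟨fun j q => M (e'.symm j) (e.symm q), fun j => c (e'.symm j), fun x j => rfl⟩
  · dsimp only
    rw [← e'.symm.sum_comp]
    refine Finset.sum_congr rfl fun j _ => ?_
    congr 3
    exact (e.symm.sum_comp fun q => M (e'.symm j) q * thresh (l q x + b q)).symm

/-- With a suitable orientation, one threshold neuron decides whether `t + ε * r` is positive for
all small `ε > 0`, including when `t = 0`. -/
lemma exists_thresh_sign {r : ℝ} (hr : r ≠ 0) : ∃ s : ℝ, ∀ t : ℝ,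
    (s * thresh (s * t) + (1 - s) / 2 = 0 ∧
      ∀ᶠ ε in nhdsWithin (0 : ℝ) (Set.Ioi 0), t + ε * r < 0) ∨
    (s * thresh (s * t) + (1 - s) / 2 = 1 ∧
      ∀ᶠ ε in nhdsWithin (0 : ℝ) (Set.Ioi 0), 0 < t + ε * r) := by
  have hlim (t : ℝ) :
      Filter.Tendsto (fun ε : ℝ => t + ε * r) (nhdsWithin 0 (Set.Ioi 0)) (nhds t) := by
    have : Continuous (fun ε : ℝ => t + ε * r) := by fun_prop
    simpa using (this.tendsto 0).mono_left nhdsWithin_le_nhds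
  rcases hr.lt_or_gt with h | h
  · refine ⟨1, fun t => ?_⟩
    rcases lt_trichotomy t 0 with ht | rfl | ht
    · exact Or.inl ⟨by simp [thresh, ht.le], (hlim t).eventually (gt_mem_nhds ht)⟩
    · refine Or.inl ⟨by simp [thresh], ?_⟩
      filter_upwards [self_mem_nhdsWithin] with ε hε
      simpa using mul_neg_of_pos_of_neg hε h
    · exact Or.inr ⟨by simp [thresh, ht], (hlim t).eventually (lt_mem_nhds ht)⟩
  · refine ⟨-1, fun t => ?_⟩
    rcases lt_trichotomy t 0 with ht | rfl | ht
    · exact Or.inl ⟨by simp [thresh, ht], (hlim t).eventually (gt_mem_nhds ht)⟩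
    · refine Or.inr ⟨by simp [thresh], ?_⟩
      filter_upwards [self_mem_nhdsWithin] with ε hε
      simpa using mul_pos hε h
    · exact Or.inr ⟨by simp [thresh, ht.le], (hlim t).eventually (lt_mem_nhds ht)⟩

/-- A function that is affine on each member of a finite closed cover whose members are pairwise
separated by hyperplanes is computed by a shortcut network with two hidden layers. Each member is
replaced by the half-open set of points that enter it when moved in a generic direction; these
half-open sets partition the space. -/
lemma sltComputes_of_cover {n : ℕ} {ι : Type*} [Fintype ι] (P : ι → Set (Fin n → ℝ))
    (hclosed : ∀ i, IsClosed (P i)) (hcov : ∀ x, ∃ i, x ∈ P i)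
    (hsep : ∀ i j, i ≠ j → ∃ (l : (Fin n → ℝ) →L[ℝ] ℝ) (u : ℝ), l ≠ 0 ∧
      (∀ x ∈ P i, l x ≤ u) ∧ ∀ x ∈ P j, u ≤ l x)
    (f : (Fin n → ℝ) → ℝ) (A : ι → Fin n → ℝ) (B : ι → ℝ)
    (hf : ∀ i, ∀ x ∈ P i, f x = (∑ k, A i k * x k) + B i) :
    SLTComputes n 2 (Fintype.card ι ^ 2) f := by
  classical
  let κ := {q : ι × ι // q.1 ≠ q.2}
  choose l u hl hlP hlQ using fun q : κ => hsep q.1.1 q.1.2 q.2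
  obtain ⟨v, hv⟩ := Module.Dual.exists_forall_ne_zero_of_forall_exists
    (fun q : κ => (l q : (Fin n → ℝ) →ₗ[ℝ] ℝ)) fun q => by
      by_contra! h
      exact hl q (ContinuousLinearMap.ext h)
  choose s hs using fun q : κ => exists_thresh_sign (hv q)
  let V (q : κ) (x : Fin n → ℝ) : ℝ := s q * thresh (s q * (l q x - u q)) + (1 - s q) / 2
  have hV (q : κ) (x : Fin n → ℝ) :
      (V q x = 0 ∧ ∀ᶠ ε in nhdsWithin (0 : ℝ) (Set.Ioi 0), l q (x + ε • v) < u q) ∨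
      (V q x = 1 ∧ ∀ᶠ ε in nhdsWithin (0 : ℝ) (Set.Ioi 0), u q < l q (x + ε • v)) := by
    have key (ε : ℝ) : l q (x + ε • v) = u q + (l q x - u q + ε * l q v) := by
      simp only [map_add, map_smul, smul_eq_mul]; ring
    refine (hs q (l q x - u q)).imp (And.imp_right fun h => ?_) (And.imp_right fun h => ?_)
    · filter_upwards [h] with ε hε
      rw [key]
      exact add_lt_of_neg_right _ hε
    · filter_upwards [h] with ε hε
      rw [key]
      exact lt_add_of_pos_right _ hε
  have hmem {i : ι} {y : Fin n → ℝ} (h : ∀ q : κ, q.1.1 = i → l q y < u q) : y ∈ P i := by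
    obtain ⟨j, hj⟩ := hcov y
    by_cases hij : i = j
    · exact hij ▸ hj
    · exact absurd (hlQ ⟨(i, j), hij⟩ y hj) (h ⟨(i, j), hij⟩ rfl).not_ge
  have hneg {i : ι} {x : Fin n → ℝ} (h : ∀ q : κ, q.1.1 = i → V q x = 0) :
      ∀ᶠ ε in nhdsWithin (0 : ℝ) (Set.Ioi 0), ∀ q : κ, q.1.1 = i → l q (x + ε • v) < u q := by
    refine Filter.eventually_all.mpr fun q => ?_
    by_cases hq : q.1.1 = i
    · rcases hV q x with h' | h'
      · exact h'.2.mono fun ε hε _ => hε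
      · exact absurd (h q hq) (by simp [h'.1])
    · exact Filter.Eventually.of_forall fun _ h => absurd h hq
  have hexists (x : Fin n → ℝ) : ∃ i, ∀ q : κ, q.1.1 = i → V q x = 0 := by
    have : ∀ᶠ ε in nhdsWithin (0 : ℝ) (Set.Ioi 0), ∀ q : κ,
        V q x = 0 ∨ u q < l q (x + ε • v) := by
      refine Filter.eventually_all.mpr fun q => ?_
      rcases hV q x with h | h
      · exact Filter.Eventually.of_forall fun _ => Or.inl h.1
      · exact h.2.mono fun _ => Or.inr
    obtain ⟨ε, hε⟩ := this.exists
    obtain ⟨i, hi⟩ := hcov (x + ε • v)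
    refine ⟨i, fun q hq => (hε q).resolve_right (not_lt.mpr (hlP q _ (hq ▸ hi)))⟩
  have hunique {x : Fin n → ℝ} {i j : ι} (hi : ∀ q : κ, q.1.1 = i → V q x = 0)
      (hj : ∀ q : κ, q.1.1 = j → V q x = 0) : i = j := by
    by_contra hij
    obtain ⟨ε, h1, h2⟩ := ((hneg hi).and (hneg hj)).exists
    exact (h1 ⟨(i, j), hij⟩ rfl).not_ge (hlQ ⟨(i, j), hij⟩ _ (hmem h2))
  have hclos {x : Fin n → ℝ} {i : ι} (hi : ∀ q : κ, q.1.1 = i → V q x = 0) : x ∈ P i := by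
    have hlim : Filter.Tendsto (fun ε : ℝ => x + ε • v) (nhdsWithin 0 (Set.Ioi 0)) (nhds x) := by
      have : Continuous (fun ε : ℝ => x + ε • v) := by fun_prop
      simpa using (this.tendsto 0).mono_left nhdsWithin_le_nhds
    exact (hclosed i).mem_of_tendsto hlim ((hneg hi).mono fun ε hε => hmem hε)
  have hVnonneg (q : κ) (x : Fin n → ℝ) : 0 ≤ V q x := by
    rcases hV q x with h | h <;> simp [h.1]
  have hcard : Fintype.card κ + Fintype.card ι = Fintype.card ι ^ 2 := by
    have h1 : Fintype.card κ = (Finset.univ : Finset ι).offDiag.card := by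
      rw [Fintype.card_subtype]
      congr 1
      ext q
      simp
    rw [h1, Finset.offDiag_card, Finset.card_univ, sq, Nat.sub_add_cancel (Nat.le_mul_self _)]
  have hnet := sltComputes_two (fun q : κ => s q • l q) (fun q => -(s q * u q))
    (fun i q => if q.1.1 = i then -s q else 0)
    (fun i => 1 / 2 - ∑ q : κ, if q.1.1 = i then (1 - s q) / 2 else 0) A B
  rw [hcard] at hnet
  convert hnet using 1
  funext x
  have hinner (i : ι) : (∑ q : κ, (if q.1.1 = i then -s q else 0) *
        thresh ((s q • l q) x + -(s q * u q))) +
        (1 / 2 - ∑ q : κ, if q.1.1 = i then (1 - s q) / 2 else 0) =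
      1 / 2 - ∑ q : κ, if q.1.1 = i then V q x else 0 := by
    rw [add_sub_left_comm, sub_eq_add_neg, sub_eq_add_neg, ← Finset.sum_neg_distrib,
      ← Finset.sum_neg_distrib, ← Finset.sum_add_distrib]
    congr 1
    refine Finset.sum_congr rfl fun q _ => ?_
    split_ifs
    · have harg : (s q • l q) x + -(s q * u q) = s q * (l q x - u q) := by
        simp only [smul_apply, smul_eq_mul]; ring
      rw [harg]
      simp only [V]
      ring
    · simp
  simp only [hinner]
  obtain ⟨i, hi⟩ := hexists x
  rw [Finset.sum_eq_single i]
  · have h0 : ∑ q : κ, (if q.1.1 = i then V q x else 0) = 0 :=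
      Finset.sum_eq_zero fun q _ => by split_ifs with h; exacts [hi q h, rfl]
    rw [h0, hf i x (hclos hi)]
    simp [thresh]
  · intro j _ hji
    obtain ⟨q, hq, hqV⟩ : ∃ q : κ, q.1.1 = j ∧ V q x ≠ 0 := by
      by_contra! h
      exact hji (hunique h hi)
    have h1 : V q x = 1 := ((hV q x).resolve_left fun h => hqV h.1).1
    have h2 : 1 ≤ ∑ q : κ, if q.1.1 = j then V q x else 0 := by
      have := Finset.single_le_sum (f := fun q : κ => if q.1.1 = j then V q x else 0)
        (fun q _ => by split_ifs; exacts [hVnonneg q x, le_rfl]) (Finset.mem_univ q)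
      simpa [hq, h1] using this
    rw [thresh, if_neg (by linarith), mul_zero]
  · simp

/-- a continuous piecewise linear `f : ℝ^n → ℝ` with `p ≥ 2` pieces is
computed exactly by a shortcut linear threshold NN with 2 hidden layers and size
at most `p² + 1`. -/
theorem stmt_17 (n p : ℕ) (hp : 2 ≤ p) (f : (Fin n → ℝ) → ℝ) (hcont : Continuous f)
    (Pc : Finset (Set (Fin n → ℝ))) (hPc : CompatiblePWL f Pc)
    (hmin : ∀ Qc : Finset (Set (Fin n → ℝ)), CompatiblePWL f Qc → Pc.card ≤ Qc.card)
    (hpieces : {P ∈ (Pc : Set (Set (Fin n → ℝ))) | polyDim P = n}.ncard = p) :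
    ∃ s : ℕ, SLTComputes n 2 s f ∧ s ≤ p ^ 2 + 1 := by
  classical
  obtain ⟨hcomplex, hcov, haff⟩ := hPc
  let S := Pc.filter fun P => (interior P).Nonempty
  have hS (P : S) : P.1 ∈ Pc ∧ (interior P.1).Nonempty := Finset.mem_filter.mp P.2
  have hpoly (P : S) : IsPolyhedron P.1 := hcomplex.1 _ (hS P).1
  have hcardS : S.card ≤ p := by
    rw [← hpieces, ← Set.ncard_coe_finset S]
    refine Set.ncard_le_ncard (fun P hP => ?_) (Pc.finite_toSet.subset fun P hP => hP.1)
    obtain ⟨h1, h2⟩ := Finset.mem_filter.mp (Finset.mem_coe.mp hP)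
    exact ⟨h1, polyDim_eq_of_interior_nonempty h2⟩
  choose A B hAB using fun P : S => haff P.1 (hS P).1
  refine ⟨Fintype.card S ^ 2, sltComputes_of_cover (fun P : S => P.1) (fun P => (hpoly P).isClosed)
    (fun x => ?_) (fun P Q hPQ => ?_) f A B fun P x hx => ?_, ?_⟩
  · obtain ⟨P, hP, hne, hx⟩ := exists_mem_interior_nonempty_of_cover Pc
      (fun P hP => (hcomplex.1 P hP).isClosed) hcov x
    exact ⟨⟨P, Finset.mem_filter.mpr ⟨hP, hne⟩⟩, hx⟩
  · exact exists_separating (hpoly P).convex (hpoly Q).convex (hS P).2 (hS Q).2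
      (hcomplex.disjoint_interior (hS P).1 (hS Q).1 (Subtype.coe_injective.ne hPQ))
  · have hx' : x ∈ closure (interior P.1) :=
      ((hpoly P).convex.closure_interior_eq_closure_of_nonempty_interior (hS P).2).ge
        (subset_closure hx)
    exact closure_minimal (fun y hy => hAB P y (interior_subset_intrinsicInterior hy))
      (isClosed_eq hcont (by fun_prop)) hx'
  · rw [Fintype.card_coe]
    exact (Nat.pow_le_pow_left hcardS 2).trans (Nat.le_succ _)
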